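/- Define J(x,y) = (2πε)^{−1/2} ∫_ℝ g(x,y) ( e^{i T₂^{x₀}[S₀](x)/ε} − e^{i S₀(x)/ε} ) e^{−(x−x₀)²/(2ε)} dx₀. Then for every ε > 0: ‖J‖² ≤ (5/12) · (sup_{x∈ℝ} |S₀'''(x)|)² · ‖g‖² · ε. -/

import Mathlib

open MeasureTheory

/-- The `L²_{x,y}` norm `(∫_ℝ ∫₀^{2π} |u(x,y)|² dy dx)^{1/2}`. -/
noncomputable def L2xy (u : ℝ → ℝ → ℂ) : ℝ :=
  (∫ x : ℝ, ∫ y in Set.Icc (0:ℝ) (2 * Real.pi), ‖u x y‖ ^ 2) ^ ((1:ℝ)/2)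

/-- Second order Taylor polynomial of `S₀` at `x₀`. -/
noncomputable def T2 (S₀ : ℝ → ℝ) (x₀ x : ℝ) : ℝ :=
  S₀ x₀ + deriv S₀ x₀ * (x - x₀) + (1/2) * deriv (deriv S₀) x₀ * (x - x₀)^2

lemma aux_taylor (S₀ : ℝ → ℝ) (hS : ContDiff ℝ 3 S₀) (M : ℝ)
    (hM : ∀ x, |iteratedDeriv 3 S₀ x| ≤ M) (x₀ x : ℝ) :
    |T2 S₀ x₀ x - S₀ x| ≤ M / 6 * |x - x₀| ^ 3 := by
  rcases eq_or_ne x₀ x with rfl | hx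
  · simp [T2]
  obtain ⟨z, -, hz⟩ := taylor_mean_remainder_lagrange_iteratedDeriv (n := 2) hx
    (f := S₀) (by exact_mod_cast hS.contDiffOn)
  have hu : UniqueDiffOn ℝ (Set.uIcc x₀ x) := uniqueDiffOn_uIcc hx
  have hm : x₀ ∈ Set.uIcc x₀ x := Set.left_mem_uIcc
  have h1 : iteratedDerivWithin 1 S₀ (Set.uIcc x₀ x) x₀ = deriv S₀ x₀ := by
    rw [iteratedDerivWithin_eq_iteratedDeriv hu (hS.contDiffAt.of_le (by norm_num)) hm,
      iteratedDeriv_one]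
  have h2 : iteratedDerivWithin 2 S₀ (Set.uIcc x₀ x) x₀ = deriv (deriv S₀) x₀ := by
    rw [iteratedDerivWithin_eq_iteratedDeriv hu (hS.contDiffAt.of_le (by norm_num)) hm,
      iteratedDeriv_succ, iteratedDeriv_one]
  have h : T2 S₀ x₀ x = taylorWithinEval S₀ 2 (Set.uIcc x₀ x) x₀ x := by
    rw [taylorWithinEval_succ, taylorWithinEval_succ, taylor_within_zero_eval]
    norm_num [h1, h2, T2, Nat.factorial]
    ring
  rw [abs_sub_comm, h, hz, abs_div, abs_mul, abs_pow]
  have : |(((2 + 1).factorial : ℕ) : ℝ)| = 6 := by norm_num [Nat.factorial]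
  rw [this]
  have := mul_le_mul_of_nonneg_right (hM z) (by positivity : 0 ≤ |x - x₀| ^ 3)
  norm_num at this ⊢
  linarith

lemma aux_exp (a b ε : ℝ) (hε : 0 < ε) :
    ‖Complex.exp (Complex.I * (a : ℝ) / (ε:ℂ)) - Complex.exp (Complex.I * (b : ℝ) / (ε:ℂ))‖
      ≤ |a - b| / ε := by
  have h : Complex.exp (Complex.I * (a : ℝ) / (ε:ℂ)) - Complex.exp (Complex.I * (b : ℝ) / (ε:ℂ))
      = Complex.exp (Complex.I * ((b / ε : ℝ) : ℂ)) *
        (Complex.exp (Complex.I * (((a - b) / ε : ℝ) : ℂ)) - 1) := by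
    rw [mul_sub, ← Complex.exp_add, mul_one]
    push_cast
    congr 2 <;> ring
  rw [h, norm_mul, Complex.norm_exp_I_mul_ofReal, one_mul]
  refine Real.norm_exp_I_mul_ofReal_sub_one_le.trans ?_
  rw [Real.norm_eq_abs, abs_div, abs_of_pos hε]

lemma aux_int (ε : ℝ) (hε : 0 < ε) :
    Integrable (fun t : ℝ => |t| ^ 3 * Real.exp (-(t ^ 2) / (2 * ε))) ∧
    ∫ t : ℝ, |t| ^ 3 * Real.exp (-(t ^ 2) / (2 * ε)) = 4 * ε ^ 2 := by
  have hb : 0 < 1 / (2 * ε) := by positivity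
  have he : ∀ t : ℝ, -(t ^ 2) / (2 * ε) = -(1 / (2 * ε)) * t ^ 2 := by intro t; ring
  constructor
  · have := (integrable_rpow_mul_exp_neg_mul_sq hb (s := 3) (by norm_num)).norm
    refine this.congr (Filter.Eventually.of_forall fun t => ?_)
    simp only [he]
    rw [norm_mul, Real.norm_eq_abs, Real.norm_of_nonneg (Real.exp_pos _).le]
    norm_cast
    rw [abs_pow]
  · have h1 := integral_comp_abs (f := fun t : ℝ => t ^ 3 * Real.exp (-(t ^ 2) / (2 * ε)))
    simp only [sq_abs] at h1
    rw [h1]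
    have h2 := integral_rpow_mul_exp_neg_mul_rpow (p := 2) (q := 3) (b := 1 / (2 * ε))
      (by norm_num) (by norm_num) hb
    have h3 : ∫ t in Set.Ioi (0:ℝ), t ^ 3 * Real.exp (-(t ^ 2) / (2 * ε))
        = ∫ x in Set.Ioi (0:ℝ), x ^ (3:ℝ) * Real.exp (-(1 / (2 * ε)) * x ^ (2:ℝ)) := by
      congr 1 with t
      rw [he]
      norm_cast
    rw [h3, h2]
    have hg : Real.Gamma ((3 + 1) / 2) = 1 := by
      norm_num
    have hp : (1 / (2 * ε)) ^ (-(3 + 1) / 2 : ℝ) = 4 * ε ^ 2 := by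
      rw [show (-(3 + 1) / 2 : ℝ) = -((2 : ℕ) : ℝ) by norm_num, Real.rpow_neg hb.le,
        Real.rpow_natCast]
      field_simp
      norm_num
    rw [hg, hp]
    ring

lemma aux_pt (ε : ℝ) (hε : 0 < ε) (S₀ : ℝ → ℝ) (hS : ContDiff ℝ 3 S₀) (M : ℝ)
    (hM : ∀ x, |iteratedDeriv 3 S₀ x| ≤ M) (x : ℝ) (c : ℂ) :
    ‖(((2 * Real.pi * ε) ^ (-(1:ℝ)/2) : ℝ) : ℂ) *
          ∫ x₀ : ℝ, c *
            (Complex.exp (Complex.I * (T2 S₀ x₀ x : ℝ) / (ε:ℂ))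
              - Complex.exp (Complex.I * (S₀ x : ℝ) / (ε:ℂ))) *
            Complex.exp (-(((x - x₀)^2 : ℝ) : ℂ) / (2 * (ε:ℂ)))‖ ^ 2
      ≤ (5/12) * M ^ 2 * ε * ‖c‖ ^ 2 := by
  obtain ⟨hi, hI⟩ := aux_int ε hε
  have hi' := (hi.comp_sub_left x).const_mul (‖c‖ * (M / (6 * ε)))
  have hM0 : 0 ≤ M := (abs_nonneg _).trans (hM 0)
  have hb : ‖∫ x₀ : ℝ, c *
            (Complex.exp (Complex.I * (T2 S₀ x₀ x : ℝ) / (ε:ℂ))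
              - Complex.exp (Complex.I * (S₀ x : ℝ) / (ε:ℂ))) *
            Complex.exp (-(((x - x₀)^2 : ℝ) : ℂ) / (2 * (ε:ℂ)))‖
      ≤ ‖c‖ * (M / (6 * ε)) * (4 * ε ^ 2) := by
    refine (norm_integral_le_of_norm_le hi' (Filter.Eventually.of_forall fun x₀ => ?_)).trans ?_
    · have h1 := aux_exp (T2 S₀ x₀ x) (S₀ x) ε hε
      have h2 := aux_taylor S₀ hS M hM x₀ x
      have h3 : ‖Complex.exp (-(((x - x₀)^2 : ℝ) : ℂ) / (2 * (ε:ℂ)))‖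
          = Real.exp (-((x - x₀) ^ 2) / (2 * ε)) := by
        rw [show -(((x - x₀)^2 : ℝ) : ℂ) / (2 * (ε:ℂ))
          = ((-((x - x₀) ^ 2) / (2 * ε) : ℝ) : ℂ) by push_cast; ring, Complex.norm_exp_ofReal]
      rw [norm_mul, norm_mul, h3, ← mul_assoc]
      refine mul_le_mul_of_nonneg_right ?_ (Real.exp_pos _).le
      rw [mul_assoc]
      refine mul_le_mul_of_nonneg_left (h1.trans ?_) (norm_nonneg _)
      calc _ ≤ (M / 6 * |x - x₀| ^ 3) / ε := by gcongr
        _ = _ := by field_simp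
    · rw [integral_const_mul,
        integral_sub_left_eq_self (fun t : ℝ => |t| ^ 3 * Real.exp (-(t ^ 2) / (2 * ε))), hI]
  have hpi := Real.pi_gt_three
  have hpos : 0 < 2 * Real.pi * ε := by positivity
  have hsq : ((2 * Real.pi * ε) ^ (-(1:ℝ)/2)) ^ 2 = (2 * Real.pi * ε)⁻¹ := by
    rw [← Real.rpow_natCast, ← Real.rpow_mul hpos.le, ← Real.rpow_neg_one]
    norm_num
  rw [norm_mul, mul_pow, Complex.norm_real, Real.norm_eq_abs, sq_abs, hsq]
  calc _ ≤ (2 * Real.pi * ε)⁻¹ * (‖c‖ * (M / (6 * ε)) * (4 * ε ^ 2)) ^ 2 := by gcongr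
    _ = (2 / (9 * Real.pi)) * (M ^ 2 * ε * ‖c‖ ^ 2) := by
      field_simp
      ring
    _ ≤ (5 / 12) * (M ^ 2 * ε * ‖c‖ ^ 2) := by
      refine mul_le_mul_of_nonneg_right ?_ (by positivity)
      rw [div_le_div_iff₀ (by positivity) (by norm_num)]
      linarith
    _ = _ := by ring

lemma aux_L2 (u : ℝ → ℝ → ℂ) :
    L2xy u ^ 2 = ∫ x : ℝ, ∫ y in Set.Icc (0:ℝ) (2 * Real.pi), ‖u x y‖ ^ 2 := by
  have h : 0 ≤ ∫ x : ℝ, ∫ y in Set.Icc (0:ℝ) (2 * Real.pi), ‖u x y‖ ^ 2 :=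
    integral_nonneg fun x => integral_nonneg fun y => by positivity
  rw [L2xy, ← Real.rpow_natCast, ← Real.rpow_mul h]
  norm_num

/-- With
`J(x,y) = (2πε)^{-1/2} ∫ g(x,y)(e^{iT₂^{x₀}[S₀](x)/ε} − e^{iS₀(x)/ε}) e^{-(x-x₀)²/(2ε)} dx₀`,
one has `‖J‖² ≤ (5/12)·(sup|S₀'''|)²·‖g‖²·ε`. -/
theorem initial_error_term_J
    (ε : ℝ) (hε : 0 < ε)
    (S₀ : ℝ → ℝ) (hS : ContDiff ℝ 3 S₀)
    (hSb : ∀ i ≤ 3, ∃ C : ℝ, ∀ x, |iteratedDeriv i S₀ x| ≤ C)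
    (g : ℝ → ℝ → ℂ) (hg : ContDiff ℝ 1 (fun p : ℝ × ℝ => g p.1 p.2))
    (hgsupp : ∃ K : Set ℝ, IsCompact K ∧ ∀ x ∉ K, ∀ y, g x y = 0)
    (hgper : ∀ x y, g x (y + 2 * Real.pi) = g x y) :
    L2xy (fun x y =>
        (((2 * Real.pi * ε) ^ (-(1:ℝ)/2) : ℝ) : ℂ) *
          ∫ x₀ : ℝ, g x y *
            (Complex.exp (Complex.I * (T2 S₀ x₀ x : ℝ) / (ε:ℂ))
              - Complex.exp (Complex.I * (S₀ x : ℝ) / (ε:ℂ))) *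
            Complex.exp (-(((x - x₀)^2 : ℝ) : ℂ) / (2 * (ε:ℂ)))) ^ 2 ≤
      (5/12) * (⨆ x : ℝ, |iteratedDeriv 3 S₀ x|) ^ 2 * L2xy g ^ 2 * ε := by
  
  obtain ⟨C, hC⟩ := hSb 3 le_rfl
  have hbdd : BddAbove (Set.range fun x : ℝ => |iteratedDeriv 3 S₀ x|) :=
    ⟨C, by rintro _ ⟨x, rfl⟩; exact hC x⟩
  set M := ⨆ x : ℝ, |iteratedDeriv 3 S₀ x| with hMdef
  have hM : ∀ x, |iteratedDeriv 3 S₀ x| ≤ M := fun x => le_ciSup hbdd x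
  have hgc : Continuous (fun p : ℝ × ℝ => g p.1 p.2) := hg.continuous
  have hg2 : Continuous (Function.uncurry fun x y : ℝ => ‖g x y‖ ^ 2) := (hgc.norm.pow 2)
  have hcont : Continuous fun x : ℝ => ∫ y in Set.Icc (0:ℝ) (2 * Real.pi), ‖g x y‖ ^ 2 :=
    continuous_parametric_integral_of_continuous hg2 isCompact_Icc
  obtain ⟨K, hK, hgK⟩ := hgsupp
  have hint : Integrable fun x : ℝ => ∫ y in Set.Icc (0:ℝ) (2 * Real.pi), ‖g x y‖ ^ 2 := by
    refine hcont.integrable_of_hasCompactSupport (HasCompactSupport.intro hK fun x hx => ?_)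
    simp [hgK x hx]
  rw [aux_L2, aux_L2]
  have key := fun x y => aux_pt ε hε S₀ hS M hM x (g x y)
  have hr : (5/12) * M ^ 2 * (∫ x : ℝ, ∫ y in Set.Icc (0:ℝ) (2 * Real.pi), ‖g x y‖ ^ 2) * ε
      = ∫ x : ℝ, (5/12) * M ^ 2 * ε * ∫ y in Set.Icc (0:ℝ) (2 * Real.pi), ‖g x y‖ ^ 2 := by
    rw [integral_const_mul]; ring
  rw [hr]
  refine integral_mono_of_nonneg
    (Filter.Eventually.of_forall fun x => integral_nonneg fun y => by positivity)
    (hint.const_mul _) (Filter.Eventually.of_forall fun x => ?_)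
  simp only
  rw [← integral_const_mul]
  refine integral_mono_of_nonneg (Filter.Eventually.of_forall fun y => by positivity)
    (Integrable.const_mul ?_ _) (Filter.Eventually.of_forall fun y => key x y)
  have : Continuous fun y : ℝ => ‖g x y‖ ^ 2 := by
    exact hg2.comp (by fun_prop : Continuous fun y : ℝ => (x, y))
  exact this.continuousOn.integrableOn_compact isCompact_Icc
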